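/- arXiv:0705.0333 — 2 statements merged into one kernel-verified Lean document; each statement's English description precedes it below -/
import Mathlib

section
/- Let R' = C^∞(ℝ^n,ℝ) be the ring of smooth real-valued functions on ℝ^n, let y ∈ ℝ^n, and let m_y = {f ∈ R' | f(y) = 0}. Then for every k ≥ 1, the k-th power ideal satisfies (m_y)^k = {f ∈ R' | the i-th iterated Fréchet derivative of f at y vanishes for all i = 0, 1, …, k−1}. -/
open scoped Manifold

/-- `m_y`: the ideal of smooth real-valued functions on `ℝ^n` vanishing at the point `y`. -/
noncomputable def mIdeal {n : ℕ} (y : EuclideanSpace ℝ (Fin n)) :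
    Ideal (ContMDiffMap 𝓘(ℝ, EuclideanSpace ℝ (Fin n)) 𝓘(ℝ, ℝ)
      (EuclideanSpace ℝ (Fin n)) ℝ (⊤ : ℕ∞)) where
  carrier := {f | f y = 0}
  add_mem' := by
    intro f g hf hg
    simp only [Set.mem_setOf_eq] at *
    simp [hf, hg]
  zero_mem' := by simp
  smul_mem' := by
    intro c f hf
    simp only [Set.mem_setOf_eq, smul_eq_mul] at *
    simp [hf]

section RadialAverage

open scoped ContDiff
open Set

universe u

variable {E F : Type u} [NormedAddCommGroup E] [NormedSpace ℝ E]
  [NormedAddCommGroup F] [NormedSpace ℝ F]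

/-- The average `∫₀¹ t ^ m • G (y + t • (x - y)) dt` of `G` along the segment from `y` to `x`. -/
noncomputable def radialAverage (y : E) (m : ℕ) (G : E → F) (x : E) : F :=
  ∫ t in (0 : ℝ)..1, t ^ m • G (y + t • (x - y))

theorem hasFDerivAt_radialAverage [FiniteDimensional ℝ E] (y : E) (m : ℕ) {G : E → F}
    (hG : ContDiff ℝ 1 G) (x : E) :
    HasFDerivAt (radialAverage y m G) (radialAverage y (m + 1) (fderiv ℝ G) x) x := by
  have hcont : Continuous G := hG.continuous
  have hcont' : Continuous (fderiv ℝ G) := hG.continuous_fderiv one_ne_zero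
  obtain ⟨C, hC⟩ := (isCompact_closedBall y (‖x - y‖ + 1)).exists_bound_of_continuousOn
    hcont'.continuousOn
  refine intervalIntegral.hasFDerivAt_integral_of_dominated_of_fderiv_le
    (F' := fun x t => t ^ (m + 1) • fderiv ℝ G (y + t • (x - y))) (bound := fun _ => C)
    (Metric.ball_mem_nhds x one_pos) (.of_forall fun z => ?_) ?_ ?_
    (.of_forall fun t ht z hz => ?_) intervalIntegrable_const (.of_forall fun t _ z _ => ?_)
  · exact (by fun_prop : Continuous fun t : ℝ => t ^ m • G (y + t • (z - y))).aestronglyMeasurable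
  · exact (by fun_prop : Continuous fun t : ℝ => t ^ m • G (y + t • (x - y))).intervalIntegrable _ _
  · exact (by fun_prop : Continuous fun t : ℝ =>
      t ^ (m + 1) • fderiv ℝ G (y + t • (x - y))).aestronglyMeasurable
  · rw [uIoc_of_le zero_le_one] at ht
    have hzy : ‖z - y‖ ≤ ‖x - y‖ + 1 := by
      have h := norm_add_le (z - x) (x - y)
      rw [sub_add_sub_cancel] at h
      linarith [mem_ball_iff_norm.1 hz]
    have hball : y + t • (z - y) ∈ Metric.closedBall y (‖x - y‖ + 1) := by
      rw [mem_closedBall_iff_norm, add_sub_cancel_left, norm_smul, Real.norm_of_nonneg ht.1.le]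
      exact (mul_le_of_le_one_left (norm_nonneg _) ht.2).trans hzy
    rw [norm_smul, norm_pow, Real.norm_of_nonneg ht.1.le]
    exact (mul_le_of_le_one_left (norm_nonneg _) (pow_le_one₀ ht.1.le ht.2)).trans (hC _ hball)
  · have hline : HasFDerivAt (fun z : E => y + t • (z - y)) (t • ContinuousLinearMap.id ℝ E) z :=
      (((hasFDerivAt_id z).sub_const y).const_smul t).const_add y
    have hG' := (hG.differentiable one_ne_zero (y + t • (z - y))).hasFDerivAt
    refine ((hG'.comp z hline).const_smul (t ^ m)).congr_fderiv ?_
    ext v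
    simp [pow_succ, mul_smul]

theorem fderiv_radialAverage [FiniteDimensional ℝ E] (y : E) (m : ℕ) {G : E → F}
    (hG : ContDiff ℝ 1 G) :
    fderiv ℝ (radialAverage y m G) = radialAverage y (m + 1) (fderiv ℝ G) :=
  funext fun x => (hasFDerivAt_radialAverage y m hG x).fderiv

theorem ContDiff.radialAverage [FiniteDimensional ℝ E] (y : E) (m : ℕ) {G : E → F}
    (hG : ContDiff ℝ ∞ G) : ContDiff ℝ ∞ (radialAverage y m G) := by
  refine contDiff_infty.2 fun r => ?_
  induction r generalizing F m with
  | zero =>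
    exact contDiff_zero.2 <| continuous_iff_continuousAt.2 fun x =>
      (hasFDerivAt_radialAverage y m (hG.of_le (by simp)) x).continuousAt
  | succ r ih =>
    have hG1 : ContDiff ℝ 1 G := hG.of_le (by simp)
    rw [Nat.cast_succ, contDiff_succ_iff_fderiv, fderiv_radialAverage y m hG1]
    exact ⟨fun x => (hasFDerivAt_radialAverage y m hG1 x).differentiableAt, by simp,
      ih (m + 1) (contDiff_infty_iff_fderiv.1 hG).2⟩

theorem iteratedFDeriv_radialAverage_eq_zero [FiniteDimensional ℝ E] (y : E) (m : ℕ)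
    {G : E → F} (hG : ContDiff ℝ ∞ G) {i : ℕ} (h : iteratedFDeriv ℝ i G y = 0) :
    iteratedFDeriv ℝ i (radialAverage y m G) y = 0 := by
  induction i generalizing F m with
  | zero =>
    have hGy : G y = 0 := by rw [← norm_eq_zero, ← norm_iteratedFDeriv_zero (𝕜 := ℝ), h, norm_zero]
    rw [← norm_eq_zero, norm_iteratedFDeriv_zero]
    simp [radialAverage, hGy]
  | succ i ih =>
    rw [← norm_eq_zero, ← norm_iteratedFDeriv_fderiv] at h ⊢
    rw [fderiv_radialAverage y m (hG.of_le (by simp)), norm_eq_zero]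
    exact ih (m + 1) (contDiff_infty_iff_fderiv.1 hG).2 (norm_eq_zero.1 h)

/-- Hadamard's lemma. -/
theorem sub_eq_radialAverage_fderiv [CompleteSpace F] (y : E) {f : E → F} (hf : ContDiff ℝ 1 f)
    (x : E) : f x - f y = radialAverage y 0 (fderiv ℝ f) x (x - y) := by
  have hcont : Continuous (fderiv ℝ f) := hf.continuous_fderiv one_ne_zero
  have hint : Continuous fun t : ℝ => t ^ 0 • fderiv ℝ f (y + t • (x - y)) := by fun_prop
  have hderiv : ∀ t : ℝ, HasDerivAt (fun t : ℝ => f (y + t • (x - y)))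
      ((t ^ 0 • fderiv ℝ f (y + t • (x - y))) (x - y)) t := fun t => by
    have hline : HasDerivAt (fun t : ℝ => y + t • (x - y)) (x - y) t := by
      simpa using ((hasDerivAt_id t).smul_const (x - y)).const_add y
    simpa [Function.comp_def] using (hf.differentiable one_ne_zero _).hasFDerivAt.comp_hasDerivAt t hline
  rw [radialAverage, ContinuousLinearMap.intervalIntegral_apply (hint.intervalIntegrable _ _),
    intervalIntegral.integral_eq_sub_of_hasDerivAt (fun t _ => hderiv t)
      ((hint.clm_apply continuous_const).intervalIntegrable _ _)]
  simp

end RadialAverage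

section VanishingJets

open scoped ContDiff

theorem iteratedFDeriv_mul_eq_zero_of_lt_succ {E : Type*} [NormedAddCommGroup E]
    [NormedSpace ℝ E] {f g : E → ℝ} {y : E} {k : ℕ} (hf : ContDiff ℝ ∞ f) (hg : ContDiff ℝ ∞ g)
    (hfy : ∀ i < k, iteratedFDeriv ℝ i f y = 0) (hgy : g y = 0) {i : ℕ} (hi : i < k + 1) :
    iteratedFDeriv ℝ i (fun x => f x * g x) y = 0 := by
  refine norm_le_zero_iff.1 ((norm_iteratedFDeriv_mul_le hf hg y
    (WithTop.coe_le_coe.2 (le_top (a := (i : ℕ∞))))).trans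
      (Finset.sum_eq_zero fun j hj => ?_).le)
  by_cases hjk : j < k
  · simp [hfy j hjk]
  · have hij : i - j = 0 := Nat.sub_eq_zero_of_le (by omega)
    rw [hij, norm_iteratedFDeriv_zero, hgy, norm_zero, mul_zero]

variable {n : ℕ} {y : EuclideanSpace ℝ (Fin n)}

/-- The ring of smooth real-valued functions on `ℝ^n`. -/
abbrev SmoothFun (n : ℕ) :=
  ContMDiffMap 𝓘(ℝ, EuclideanSpace ℝ (Fin n)) 𝓘(ℝ, ℝ) (EuclideanSpace ℝ (Fin n)) ℝ (⊤ : ℕ∞)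

theorem mem_mIdeal {f : SmoothFun n} : f ∈ mIdeal y ↔ f y = 0 := Iff.rfl

theorem iteratedFDeriv_eq_zero_of_mem_pow_mIdeal {k : ℕ} {f : SmoothFun n}
    (hf : f ∈ mIdeal y ^ k) : ∀ i < k, iteratedFDeriv ℝ i f y = 0 := by
  induction k generalizing f with
  | zero => simp
  | succ k ih =>
    rw [pow_succ] at hf
    refine Submodule.mul_induction_on hf (fun g hg h hh i hi => ?_) fun g h hg hh i hi => ?_
    · rw [ContMDiffMap.coe_mul]
      exact iteratedFDeriv_mul_eq_zero_of_lt_succ g.contMDiff.contDiff h.contMDiff.contDiff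
        (ih hg) (mem_mIdeal.1 hh) hi
    · have hle : (i : ℕ∞ω) ≤ ∞ := WithTop.coe_le_coe.2 le_top
      rw [ContMDiffMap.coe_add, iteratedFDeriv_add_apply
        (g.contMDiff.contDiff.contDiffAt.of_le hle) (h.contMDiff.contDiff.contDiffAt.of_le hle),
        hg i hi, hh i hi, add_zero]

theorem mem_pow_mIdeal_of_iteratedFDeriv_eq_zero {k : ℕ} {f : SmoothFun n}
    (hf : ∀ i < k, iteratedFDeriv ℝ i f y = 0) : f ∈ mIdeal y ^ k := by
  induction k generalizing f with
  | zero => simp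
  | succ k ih =>
    have hfs : ContDiff ℝ ∞ f := f.contMDiff.contDiff
    have hf' : ContDiff ℝ ∞ (fderiv ℝ f) := (contDiff_infty_iff_fderiv.1 hfs).2
    have hfy : f y = 0 := by
      rw [← norm_eq_zero, ← norm_iteratedFDeriv_zero (𝕜 := ℝ), hf 0 k.succ_pos, norm_zero]
    have hH := hf'.radialAverage y 0
    let e (j : Fin n) : EuclideanSpace ℝ (Fin n) := EuclideanSpace.single j 1
    let ev (j : Fin n) : (EuclideanSpace ℝ (Fin n) →L[ℝ] ℝ) →L[ℝ] ℝ :=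
      ContinuousLinearMap.apply ℝ ℝ (e j)
    let g (j : Fin n) : SmoothFun n :=
      ⟨ev j ∘ radialAverage y 0 (fderiv ℝ f), ((ev j).contDiff.comp hH).contMDiff⟩
    let c (j : Fin n) : SmoothFun n :=
      ⟨fun x => x j - y j, ContDiff.contMDiff (by fun_prop)⟩
    have hg (j : Fin n) : g j ∈ mIdeal y ^ k := ih fun i hi => by
      have hfi : iteratedFDeriv ℝ i (fderiv ℝ f) y = 0 := by
        rw [← norm_eq_zero, norm_iteratedFDeriv_fderiv, hf _ (Nat.succ_lt_succ hi), norm_zero]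
      change iteratedFDeriv ℝ i (ev j ∘ radialAverage y 0 (fderiv ℝ f)) y = 0
      rw [(ev j).iteratedFDeriv_comp_left hH.contDiffAt
        (WithTop.coe_le_coe.2 (le_top (a := (i : ℕ∞)))),
        iteratedFDeriv_radialAverage_eq_zero y 0 hf' hfi]
      ext
      simp
    have hc (j : Fin n) : c j ∈ mIdeal y := mem_mIdeal.2 (sub_self (y j))
    have hsum : f = ∑ j, g j * c j := by
      ext x
      have hx : x - y = ∑ j, (x j - y j) • e j := by
        ext l
        simp [e, Finset.sum_apply, Pi.single_apply]
      have hadamard := sub_eq_radialAverage_fderiv y (hfs.of_le (by simp)) x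
      rw [hfy, sub_zero, hx, map_sum] at hadamard
      rw [hadamard, ← ContMDiffMap.coeFnAddMonoidHom_apply, map_sum, Finset.sum_apply]
      exact Finset.sum_congr rfl fun j _ => by
        rw [map_smul, smul_eq_mul, mul_comm]
        rfl
    rw [hsum, pow_succ]
    exact Ideal.sum_mem _ fun j _ => Ideal.mul_mem_mul (hg j) (hc j)

end VanishingJets

/-- For `y ∈ ℝ^n` and `k ≥ 1`, the `k`-th power of the maximal ideal `m_y` in `C^∞(ℝ^n, ℝ)`
consists exactly of the smooth functions whose iterated (Fréchet) derivatives at `y` of order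
`0, 1, …, k−1` all vanish. -/
theorem mem_pow_mIdeal_iff_iteratedFDeriv_eq_zero {n : ℕ} (y : EuclideanSpace ℝ (Fin n))
    (k : ℕ) (hk : 1 ≤ k)
    (f : ContMDiffMap 𝓘(ℝ, EuclideanSpace ℝ (Fin n)) 𝓘(ℝ, ℝ) (EuclideanSpace ℝ (Fin n)) ℝ (⊤ : ℕ∞)) :
    f ∈ mIdeal y ^ k ↔ ∀ i < k, iteratedFDeriv ℝ i (⇑f) y = 0 := by
  exact ⟨iteratedFDeriv_eq_zero_of_mem_pow_mIdeal, mem_pow_mIdeal_of_iteratedFDeriv_eq_zero⟩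
end

section
/- Let E be a finite-dimensional real normed vector space, g : ℝ^m → E a smooth function, r ≥ 1, and x_0, …, x_r ∈ ℝ^m. For 0 ≤ i, j ≤ r with i ≠ j, the following holds: r!·∫_{T_r} Dg(σ(t))(x_j − x_i) dt = r·( (r−1)!·∫_{T_{r−1}} g(∂_iσ(s)) ds − (r−1)!·∫_{T_{r−1}} g(∂_jσ(s)) ds ), where Dg is the Fréchet derivative of g, σ : T_r → ℝ^m is the affine parametrization σ(t) = x_0 + Σ_{l=1}^r t_l(x_l − x_0) of the simplex with vertices x_0,…,x_r, and ∂_iσ is the corresponding affine parametrization of the simplex with vertices x_0,…,x_{i−1},x_{i+1},…,x_r. -/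
open MeasureTheory

/-- The standard `r`-simplex `T_r = {t ∈ ℝ^r | t_l ≥ 0, ∑ t_l ≤ 1}` (of Lebesgue volume `1/r!`). -/
def simplexSet (r : ℕ) : Set (Fin r → ℝ) :=
  {t | (∀ l, 0 ≤ t l) ∧ ∑ l, t l ≤ 1}

/-- The affine parametrization `[x_0, …, x_k] : T_k → ℝ^m`,
`t ↦ x_0 + ∑_{l=1}^k t_l (x_l − x_0)`, of the simplex with vertices `x_0, …, x_k`. -/
def simplexMap {F : Type*} [AddCommGroup F] [Module ℝ F] {k : ℕ} (x : Fin (k + 1) → F)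
    (t : Fin k → ℝ) : F :=
  x 0 + ∑ l : Fin k, t l • (x l.succ - x 0)

section
variable {F E : Type*} [NormedAddCommGroup F] [NormedSpace ℝ F] [NormedAddCommGroup E]
  [NormedSpace ℝ E]

theorem isClosed_simplexSet (r : ℕ) : IsClosed (simplexSet r) := by
  have h : simplexSet r = (⋂ l, {t | 0 ≤ t l}) ∩ {t | ∑ l, t l ≤ 1} := by
    ext t; simp [simplexSet]
  rw [h]
  exact (isClosed_iInter fun l => isClosed_le (by fun_prop) (by fun_prop)).inter
    (isClosed_le (by fun_prop) (by fun_prop))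

theorem isCompact_simplexSet (r : ℕ) : IsCompact (simplexSet r) := by
  refine (isCompact_Icc (a := (0 : Fin r → ℝ)) (b := 1)).of_isClosed_subset
    (isClosed_simplexSet r) fun t ht => ⟨ht.1, fun l => ?_⟩
  exact (Finset.single_le_sum (fun k _ => ht.1 k) (Finset.mem_univ l)).trans ht.2

theorem insertNth_mem_simplexSet_iff {n : ℕ} (l : Fin (n + 1)) (u : ℝ) (s : Fin n → ℝ) :
    l.insertNth (α := fun _ => ℝ) u s ∈ simplexSet (n + 1) ↔
      s ∈ simplexSet n ∧ u ∈ Set.Icc 0 (1 - ∑ k, s k) := by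
  simp only [simplexSet, Set.mem_ofPred_eq, Fin.forall_iff_succAbove l, Fin.insertNth_apply_same,
    Fin.insertNth_apply_succAbove, Fin.sum_univ_succAbove _ l, Set.mem_Icc]
  constructor
  · rintro ⟨⟨hu, hs⟩, h⟩
    exact ⟨⟨hs, by linarith⟩, hu, by linarith⟩
  · rintro ⟨⟨hs, -⟩, hu, h⟩
    exact ⟨⟨hu, hs⟩, by linarith⟩

/-- Fubini on the simplex, integrating out the `l`-th coordinate first. -/
theorem setIntegral_simplexSet_succ {n : ℕ} (l : Fin (n + 1)) {f : (Fin (n + 1) → ℝ) → E}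
    (hf : Continuous f) :
    ∫ t in simplexSet (n + 1), f t =
      ∫ s in simplexSet n, ∫ u in (0 : ℝ)..(1 - ∑ k, s k),
        f (l.insertNth (α := fun _ => ℝ) u s) := by
  have hm (r : ℕ) : MeasurableSet (simplexSet r) := (isClosed_simplexSet r).measurableSet
  have hint : Integrable ((simplexSet (n + 1)).indicator f) :=
    (hf.continuousOn.integrableOn_compact (isCompact_simplexSet _)).integrable_indicator (hm _)
  have hmp := (volume_preserving_piFinSuccAbove (fun _ : Fin (n + 1) => ℝ) l).symm
  rw [← integral_indicator (hm _), ← hmp.integral_comp',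
    Measure.volume_eq_prod, integral_prod_symm, ← integral_indicator (hm _)]
  · congr 1 with s
    by_cases hs : s ∈ simplexSet n
    · rw [Set.indicator_of_mem hs,
        intervalIntegral.integral_of_le (sub_nonneg.2 hs.2), ← integral_Icc_eq_integral_Ioc,
        ← integral_indicator measurableSet_Icc]
      congr 1 with u
      by_cases hu : u ∈ Set.Icc 0 (1 - ∑ k, s k)
      · rw [Set.indicator_of_mem hu]
        exact Set.indicator_of_mem ((insertNth_mem_simplexSet_iff l u s).2 ⟨hs, hu⟩) f
      · rw [Set.indicator_of_notMem hu]
        exact Set.indicator_of_notMem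
          (fun h => hu ((insertNth_mem_simplexSet_iff l u s).1 h).2) f
    · rw [Set.indicator_of_notMem hs]
      refine integral_eq_zero_of_ae (.of_forall fun u => ?_)
      exact Set.indicator_of_notMem
        (fun h => hs ((insertNth_mem_simplexSet_iff l u s).1 h).1) f
  · exact (hmp.integrable_comp_emb (MeasurableEquiv.measurableEmbedding _)).2 hint

theorem continuous_simplexMap {k : ℕ} (x : Fin (k + 1) → F) : Continuous (simplexMap x) := by
  unfold simplexMap; fun_prop

theorem simplexMap_insertNth {n : ℕ} (x : Fin (n + 2) → F) (l : Fin (n + 1)) (u : ℝ)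
    (s : Fin n → ℝ) :
    simplexMap x (l.insertNth (α := fun _ => ℝ) u s) =
      simplexMap (x ∘ l.succ.succAbove) s + u • (x l.succ - x 0) := by
  simp only [simplexMap, Fin.sum_univ_succAbove _ l, Fin.insertNth_apply_same,
    Fin.insertNth_apply_succAbove, Function.comp_apply, Fin.succ_succAbove_succ,
    Fin.succ_succAbove_zero]
  abel

/-- The average over a simplex does not change when a vertex is moved to the front. -/
theorem setIntegral_simplexMap_cons_succAbove {n : ℕ} (y : Fin (n + 1) → F) (l : Fin (n + 1))
    (g : F → E) :
    ∫ s in simplexSet n, g (simplexMap (Fin.cons (y l) (y ∘ l.succAbove)) s) =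
      ∫ s in simplexSet n, g (simplexMap y s) := by
  cases l using Fin.cases with
  | zero =>
    have : (Fin.cons (y 0) (y ∘ Fin.succAbove 0) : Fin (n + 1) → F) = y := by
      ext k; cases k using Fin.cases <;> simp
    rw [this]
  | succ k =>
    obtain _ | n := n
    · exact k.elim0
    let φ : (Fin (n + 1) → ℝ) → (Fin (n + 1) → ℝ) := fun t =>
      k.insertNth (α := fun _ => ℝ) (1 - ∑ i, t i) (t ∘ Fin.succ)
    have hφ : MeasurePreserving φ volume volume := by
      have hskew : MeasurePreserving
          (fun p : (Fin n → ℝ) × ℝ => (p.1, 1 - ∑ i, p.1 i - p.2)) :=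
        (MeasurePreserving.id _).skew_product
          (g := fun (s : Fin n → ℝ) (u : ℝ) => 1 - ∑ i, s i - u)
          (by unfold Function.uncurry; fun_prop)
          (.of_forall fun s => (Measure.measurePreserving_sub_left volume _).map_eq)
      have hcomp := (volume_preserving_piFinSuccAbove (fun _ : Fin (n + 1) => ℝ) k).symm.comp
        (Measure.measurePreserving_swap.comp (hskew.comp (Measure.measurePreserving_swap.comp
          (volume_preserving_piFinSuccAbove (fun _ : Fin (n + 1) => ℝ) 0))))
      have hφ_eq (t : Fin (n + 1) → ℝ) : φ t = k.insertNth (α := fun _ => ℝ)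
          (1 - ∑ i, t (Fin.succAbove 0 i) - t 0) (t ∘ Fin.succAbove 0) := by
        simp only [φ, Fin.sum_univ_succ, Fin.succAbove_zero]
        congr 1
        ring
      exact (funext hφ_eq : φ = _) ▸ hcomp
    have hinj : Function.Injective φ := fun t t' h => by
      obtain ⟨hs, ht⟩ := (Fin.insertNth_inj (α := fun _ => ℝ)).1 h
      have ht' (a : Fin n) : t a.succ = t' a.succ := congrFun ht a
      simp only [Fin.sum_univ_succ, ht'] at hs
      ext a
      cases a using Fin.cases with
      | zero => linarith
      | succ a => exact ht' a
    have hpre : φ ⁻¹' simplexSet (n + 1) = simplexSet (n + 1) := by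
      ext t
      rw [Set.mem_preimage, insertNth_mem_simplexSet_iff]
      simp only [simplexSet, Set.mem_ofPred_eq, Fin.forall_fin_succ, Fin.sum_univ_succ,
        Set.mem_Icc, Function.comp_apply]
      constructor
      · rintro ⟨⟨hs, -⟩, h, h'⟩
        exact ⟨⟨by linarith, hs⟩, by linarith⟩
      · rintro ⟨⟨h, hs⟩, h'⟩
        exact ⟨⟨hs, by linarith⟩, by linarith, by linarith⟩
    symm
    rw [← hφ.setIntegral_preimage_emb (hφ.measurable.measurableEmbedding hinj), hpre]
    congr 1 with t
    congr 1
    rw [simplexMap, Fin.sum_univ_succAbove _ k]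
    simp only [simplexMap, φ, Fin.insertNth_apply_same, Fin.insertNth_apply_succAbove,
      Function.comp_apply, Fin.sum_univ_succ, Fin.cons_zero, Fin.cons_succ,
      Fin.succ_succAbove_zero, Fin.succ_succAbove_succ, smul_sub, sub_smul, add_smul, one_smul,
      Finset.sum_sub_distrib, Finset.sum_smul]
    abel

theorem setIntegral_fderiv_simplexMap [CompleteSpace E] {g : F → E} (hg : ContDiff ℝ 1 g) {n : ℕ}
    (x : Fin (n + 2) → F) (l : Fin (n + 1)) :
    ∫ t in simplexSet (n + 1), fderiv ℝ g (simplexMap x t) (x l.succ - x 0) =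
      (∫ s in simplexSet n, g (simplexMap (x ∘ Fin.succAbove 0) s)) -
        ∫ s in simplexSet n, g (simplexMap (x ∘ l.succ.succAbove) s) := by
  have hint (y : Fin (n + 1) → F) :
      IntegrableOn (fun s => g (simplexMap y s)) (simplexSet n) :=
    (hg.continuous.comp (continuous_simplexMap y)).continuousOn.integrableOn_compact
      (isCompact_simplexSet n)
  have hd : Continuous (fderiv ℝ g) := hg.continuous_fderiv one_ne_zero
  have hσ := continuous_simplexMap x
  rw [← setIntegral_simplexMap_cons_succAbove (x ∘ Fin.succAbove 0) l,
    ← integral_sub (hint _) (hint _), setIntegral_simplexSet_succ l (by fun_prop)]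
  congr 1 with s
  have hderiv (u : ℝ) : HasDerivAt
      (fun u : ℝ => g (simplexMap x (l.insertNth (α := fun _ => ℝ) u s)))
      (fderiv ℝ g (simplexMap x (l.insertNth (α := fun _ => ℝ) u s)) (x l.succ - x 0)) u := by
    refine ((hg.differentiable one_ne_zero _).hasFDerivAt).comp_hasDerivAt u ?_
    simp only [simplexMap_insertNth]
    simpa using ((hasDerivAt_id u).smul_const (x l.succ - x 0)).const_add
        (simplexMap (x ∘ l.succ.succAbove) s)
  rw [intervalIntegral.integral_eq_sub_of_hasDerivAt (fun u _ => hderiv u)]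
  · simp only [simplexMap_insertNth, zero_smul, add_zero]
    congr 2
    simp only [simplexMap, Function.comp_apply, Fin.cons_zero, Fin.cons_succ, Fin.succAbove_zero,
      Fin.succ_succAbove_succ, Fin.succ_succAbove_zero, smul_sub, sub_smul, one_smul,
      Finset.sum_sub_distrib, Finset.sum_smul]
    abel
  · apply Continuous.intervalIntegrable
    simp only [simplexMap_insertNth]
    fun_prop

end

/-- Glaeser-type integration by parts on simplices: for smooth `g : ℝ^m → E`, vertices
`x_0, …, x_r` (`r = n + 1 ≥ 1`) and `i ≠ j`, the average over the simplex `[x_0, …, x_r]` of the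
derivative of `g` in the direction `x_j − x_i` equals `r` times the difference between the
averages of `g` over the `i`-th and `j`-th faces. -/
theorem average_deriv_eq_sub_average_faces {m : ℕ} {E : Type*} [NormedAddCommGroup E]
    [NormedSpace ℝ E] [FiniteDimensional ℝ E]
    (g : EuclideanSpace ℝ (Fin m) → E) (hg : ContDiff ℝ (⊤ : ℕ∞) g)
    (n : ℕ) (x : Fin (n + 2) → EuclideanSpace ℝ (Fin m)) (i j : Fin (n + 2)) (hij : i ≠ j) :
    ((n + 1).factorial : ℝ) • ∫ t in simplexSet (n + 1), fderiv ℝ g (simplexMap x t) (x j - x i)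
      = ((n + 1 : ℕ) : ℝ) •
        ((n.factorial : ℝ) • (∫ s in simplexSet n, g (simplexMap (x ∘ i.succAbove) s))
          - (n.factorial : ℝ) • ∫ s in simplexSet n, g (simplexMap (x ∘ j.succAbove) s)) := by
  have hg1 : ContDiff ℝ 1 g := hg.of_le (by exact_mod_cast le_top)
  have hd : Continuous (fderiv ℝ g) := hg1.continuous_fderiv one_ne_zero
  have hσ := continuous_simplexMap x
  have key (k : Fin (n + 2)) :
      ∫ t in simplexSet (n + 1), fderiv ℝ g (simplexMap x t) (x k - x 0) =
        (∫ s in simplexSet n, g (simplexMap (x ∘ Fin.succAbove 0) s)) -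
          ∫ s in simplexSet n, g (simplexMap (x ∘ k.succAbove) s) := by
    cases k using Fin.cases with
    | zero => simp
    | succ l => exact setIntegral_fderiv_simplexMap hg1 x l
  have hint (v : EuclideanSpace ℝ (Fin m)) :
      IntegrableOn (fun t => fderiv ℝ g (simplexMap x t) v) (simplexSet (n + 1)) :=
    (hd.comp hσ |>.clm_apply continuous_const).continuousOn.integrableOn_compact
      (isCompact_simplexSet _)
  have hsub : ∫ t in simplexSet (n + 1), fderiv ℝ g (simplexMap x t) (x j - x i) =
      (∫ s in simplexSet n, g (simplexMap (x ∘ i.succAbove) s)) -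
        ∫ s in simplexSet n, g (simplexMap (x ∘ j.succAbove) s) := by
    rw [← sub_sub_sub_cancel_left _ _ (∫ s in simplexSet n, g (simplexMap (x ∘ Fin.succAbove 0) s)),
      ← key i, ← key j, ← integral_sub (hint _) (hint _)]
    simp only [← map_sub, sub_sub_sub_cancel_right]
  rw [hsub, ← smul_sub, smul_smul, Nat.factorial_succ, Nat.cast_mul]
end
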